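/- arXiv:1312.1657 — 2 statements merged into one kernel-verified Lean document; each statement's English description precedes it below -/
import Mathlib

section
/- Suppose K is algebraically closed. Let B₁, B₂ be two linearly independent symplectic forms on E and let V ⊆ E be a k-dimensional subspace isotropic with respect to both B₁ and B₂. Then dim_K T(V) = k(n−k) − 2·(k choose 2) if and only if there do not exist scalars (a,b) ∈ K² with (a,b) ≠ (0,0) and a 2-dimensional subspace V' ⊆ V such that (aB₁ + bB₂)(v', e) = 0 for all v' ∈ V' and all e ∈ E. -/
open Module

def IsSymplectic {K E : Type*} [Field K] [AddCommGroup E] [Module K E]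
    (B : E →ₗ[K] E →ₗ[K] K) : Prop :=
  (∀ v, B v v = 0) ∧ ∀ v, (∀ w, B v w = 0) → v = 0

def IsIsotropic {K E : Type*} [Field K] [AddCommGroup E] [Module K E]
    (B : E →ₗ[K] E →ₗ[K] K) (V : Submodule K E) : Prop :=
  ∀ v ∈ V, ∀ w ∈ V, B v w = 0

def symTV {K E : Type*} [Field K] [AddCommGroup E] [Module K E]
    (V : Submodule K E) {m : ℕ}
    (Bbar : Fin m → (V →ₗ[K] (E ⧸ V) →ₗ[K] K)) :
    Submodule K (V →ₗ[K] E ⧸ V) where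
  carrier := {f | ∀ t (v v' : V), Bbar t v (f v') = Bbar t v' (f v)}
  add_mem' := by
    intro f g hf hg t v v'
    simp only [LinearMap.add_apply, map_add]
    rw [hf t v v', hg t v v']
  zero_mem' := by
    intro t v v'
    simp
  smul_mem' := by
    intro c f hf t v v'
    simp only [LinearMap.smul_apply, map_smul]
    rw [hf t v v']

/-- An endomorphism `S` with `β (S x) x = 0` for a symplectic form `β` on a nonzero space over an
algebraically closed field has an eigenspace of dimension at least two. -/
theorem exists_linearIndependent_eigenvectors_of_alternating
    {K U : Type*} [Field K] [IsAlgClosed K] [AddCommGroup U] [Module K U]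
    [FiniteDimensional K U] [Nontrivial U] (β : U →ₗ[K] U →ₗ[K] K) (hβ : IsSymplectic β)
    (S : U →ₗ[K] U) (hS : ∀ x, β (S x) x = 0) :
    ∃ (c : K) (x y : U), S x = c • x ∧ S y = c • y ∧ LinearIndependent K ![x, y] := by
  obtain ⟨c, hc⟩ := Module.End.exists_eigenvalue S
  obtain ⟨u, hu⟩ := hc.exists_hasEigenvector
  have hu0 : u ≠ 0 := hu.2
  have hSu : S u = c • u := hu.apply_eq_smul
  by_contra! hno
  let N : Module.End K U := S - c • LinearMap.id
  have hN : ∀ x, N x = S x - c • x := fun x => by simp [N]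
  have hNu : N u = 0 := by rw [hN, hSu, sub_self]
  have hNalt : ∀ x, β (N x) x = 0 := fun x => by simp [hN, hS, hβ.1]
  have hskew : ∀ x y, β x y = -β y x := fun x y => by
    have h := hβ.1 (x + y)
    simp only [map_add, LinearMap.add_apply, hβ.1, zero_add, add_zero] at h
    exact eq_neg_of_add_eq_zero_right h
  have hadj : ∀ x y, β (N x) y = β x (N y) := fun x y => by
    have h := hNalt (x + y)
    simp only [map_add, LinearMap.add_apply, hNalt, zero_add, add_zero] at h
    rw [hskew x (N y)]
    exact eq_neg_of_add_eq_zero_right h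
  have hpow : ∀ (m : ℕ) (w : U), β ((N ^ m) w) w = 0 := by
    intro m
    induction m using Nat.twoStepInduction with
    | zero => simpa using hβ.1
    | one => simpa using hNalt
    | more m ih _ =>
      intro w
      rw [pow_succ', Module.End.mul_apply, hadj, pow_succ, Module.End.mul_apply]
      exact ih (N w)
  have hker : LinearMap.ker N ≤ Submodule.span K {u} := by
    intro y hy
    by_contra hyu
    refine hno c u y hSu ?_ ?_
    · rw [LinearMap.mem_ker, hN] at hy
      exact sub_eq_zero.1 hy
    · refine (LinearIndependent.pair_iff' hu0).2 fun a ha => hyu ?_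
      exact Submodule.mem_span_singleton.2 ⟨a, ha⟩
  have hrange : LinearMap.range N = LinearMap.ker (β u) := by
    apply Submodule.eq_of_le_of_finrank_le
    · rintro _ ⟨w, rfl⟩
      rw [LinearMap.mem_ker, ← hadj, hNu, map_zero, LinearMap.zero_apply]
    · have hβu : β u ≠ 0 := fun h => hu0 (hβ.2 u fun w => by rw [h, LinearMap.zero_apply])
      have h1 := Module.Dual.finrank_ker_add_one_of_ne_zero hβu
      have h2 := N.finrank_range_add_finrank_ker
      have h3 := Submodule.finrank_mono hker
      rw [finrank_span_singleton hu0] at h3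
      omega
  have hchain : ∀ m : ℕ, ∃ w, (N ^ m) w = u := by
    intro m
    induction m with
    | zero => exact ⟨u, by simp⟩
    | succ m ih =>
      obtain ⟨w, hw⟩ := ih
      have : w ∈ LinearMap.range N := by
        rw [hrange, LinearMap.mem_ker, ← hw]
        exact hpow m w
      obtain ⟨z, rfl⟩ := this
      exact ⟨z, by rw [pow_succ, Module.End.mul_apply, hw]⟩
  obtain ⟨w, hw⟩ := hchain (finrank K U)
  have hw' : w ∈ LinearMap.ker (N ^ (finrank K U + 1)) := by
    rw [LinearMap.mem_ker, pow_succ', Module.End.mul_apply, hw, hNu]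
  rw [Module.End.ker_pow_eq_ker_pow_finrank_of_le (Nat.le_succ _), LinearMap.mem_ker, hw] at hw'
  exact hu0 hw'

/-- Over an algebraically closed field, the pencil spanned by a symplectic form and an alternating
form on a nonzero space has a member whose kernel is at least two-dimensional. -/
theorem exists_linearIndependent_pencil_kernel
    {K U : Type*} [Field K] [IsAlgClosed K] [AddCommGroup U] [Module K U]
    [FiniteDimensional K U] [Nontrivial U] (β γ : U →ₗ[K] U →ₗ[K] K) (hβ : IsSymplectic β)
    (hγ : ∀ x, γ x x = 0) :
    ∃ (c : K) (x y : U), γ x = c • β x ∧ γ y = c • β y ∧ LinearIndependent K ![x, y] := by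
  have hinj : Function.Injective β := by
    refine LinearMap.ker_eq_bot.1 (LinearMap.ker_eq_bot'.2 fun x hx => hβ.2 x fun w => ?_)
    rw [hx, LinearMap.zero_apply]
  let e : U ≃ₗ[K] Dual K U :=
    LinearMap.linearEquivOfInjective β hinj Subspace.dual_finrank_eq.symm
  have hS : ∀ x, β (e.symm (γ x)) = γ x := fun x => e.apply_symm_apply (γ x)
  obtain ⟨c, x, y, hx, hy, hxy⟩ :=
    exists_linearIndependent_eigenvectors_of_alternating β hβ (e.symm.toLinearMap.comp γ)
      fun x => (LinearMap.congr_fun (hS x) x).trans (hγ x)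
  refine ⟨c, x, y, ?_, ?_, hxy⟩
  · rw [← hS, ← map_smul]
    exact congrArg β hx
  · rw [← hS, ← map_smul]
    exact congrArg β hy

/-- Two alternating bivectors with the same kernel, one of them nonzero, have a combination
whose kernel exceeds the common kernel by at least two dimensions. -/
theorem exists_pencil_kernel_of_alternating
    {K V : Type*} [Field K] [IsAlgClosed K] [AddCommGroup V] [Module K V]
    [FiniteDimensional K V] (p q : Dual K V →ₗ[K] V) (hp : ∀ x : Dual K V, x (p x) = 0)
    (hq : ∀ x : Dual K V, x (q x) = 0) (hpq : ∀ x, p x = 0 ↔ q x = 0) (hq0 : q ≠ 0) :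
    ∃ (c : K) (x y : Dual K V), p x = c • q x ∧ p y = c • q y ∧
      LinearIndependent K ![q x, q y] := by
  have skew : ∀ r : Dual K V →ₗ[K] V, (∀ x : Dual K V, x (r x) = 0) →
      ∀ x y : Dual K V, y (r x) = -x (r y) := by
    intro r hr x y
    have h := hr (x + y)
    simp only [map_add, LinearMap.add_apply, hr, zero_add, add_zero] at h
    exact eq_neg_of_add_eq_zero_left h
  obtain ⟨C, hC⟩ := (LinearMap.ker q).exists_isCompl
  have hinj : ∀ x ∈ C, q x = 0 → x = 0 := fun x hx h =>
    Submodule.disjoint_def.1 hC.disjoint x h hx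
  have hext : ∀ v : V, (∀ y ∈ C, y v = 0) → (∀ y ∈ LinearMap.ker q, y v = 0) → v = 0 := by
    intro v h1 h2
    refine (Module.forall_dual_apply_eq_zero_iff K v).1 fun y => ?_
    have hy : y ∈ LinearMap.ker q ⊔ C := by rw [hC.sup_eq_top]; trivial
    obtain ⟨y₁, hy₁, y₂, hy₂, rfl⟩ := Submodule.mem_sup.1 hy
    rw [LinearMap.add_apply, h2 _ hy₁, h1 _ hy₂, add_zero]
  let form (r : Dual K V →ₗ[K] V) : C →ₗ[K] C →ₗ[K] K :=
    ((LinearMap.id (R := K) (M := Dual K V)).flip.compl₂ C.subtype).comp (r.comp C.subtype)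
  have hform : ∀ r x y, form r x y = (y : Dual K V) (r x) := fun r x y => rfl
  have hβ : IsSymplectic (K := K) (E := C) (form q) := by
    refine ⟨fun x => hq _, fun x hx => ?_⟩
    refine Subtype.ext (hinj _ x.2 (hext _ (fun y hy => hx ⟨y, hy⟩) fun y hy => ?_))
    rw [skew q hq, LinearMap.mem_ker.1 hy, map_zero, neg_zero]
  have : Nontrivial C := by
    rw [Submodule.nontrivial_iff_ne_bot]
    rintro rfl
    apply hq0
    rw [← LinearMap.ker_eq_top]
    simpa using hC.sup_eq_top
  obtain ⟨c, x, y, hx, hy, hxy⟩ :=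
    exists_linearIndependent_pencil_kernel (K := K) (U := C) (form q) (form p) hβ fun x => hp _
  have heig : ∀ x : C, form p x = c • form q x → p x = c • q x := by
    intro x hx
    refine sub_eq_zero.1 (hext _ (fun y hy => ?_) fun y hy => ?_)
    · have h := LinearMap.congr_fun hx ⟨y, hy⟩
      rw [LinearMap.smul_apply, hform, hform] at h
      rw [map_sub, map_smul, ← h, sub_self]
    · rw [map_sub, map_smul, skew p hp, skew q hq, LinearMap.mem_ker.1 hy,
        (hpq y).2 (LinearMap.mem_ker.1 hy)]
      simp
  refine ⟨c, x, y, heig x hx, heig y hy, ?_⟩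
  have h := hxy.map' (q.comp C.subtype) (LinearMap.ker_eq_bot'.2 fun z hz =>
    Subtype.ext (hinj _ z.2 hz))
  have heq : ![q x, q y] = q.comp C.subtype ∘ ![x, y] := by
    funext i
    fin_cases i <;> rfl
  rwa [heq]

theorem card_subtype_fin_prod_lt (k : ℕ) :
    Fintype.card {p : Fin k × Fin k // p.1 < p.2} = k.choose 2 := by
  rw [Fintype.card_subtype, ← Finset.univ_product_univ, Finset.card_product_filter_lt,
    Finset.card_univ, Fintype.card_fin]

/-- The defining equations of `symTV`, evaluated on pairs of vectors of a basis. -/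
noncomputable def symDefect {K E ι : Type*} [Field K] [AddCommGroup E] [Module K E] [LinearOrder ι]
    {V : Submodule K E} {m : ℕ} (b : Basis ι K V)
    (Bbar : Fin m → (V →ₗ[K] (E ⧸ V) →ₗ[K] K)) :
    (V →ₗ[K] E ⧸ V) →ₗ[K] (Fin m × {p : ι × ι // p.1 < p.2} → K) where
  toFun f := fun s =>
    Bbar s.1 (b s.2.1.1) (f (b s.2.1.2)) - Bbar s.1 (b s.2.1.2) (f (b s.2.1.1))
  map_add' f g := by
    ext s
    simp only [LinearMap.add_apply, map_add, Pi.add_apply]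
    ring
  map_smul' c f := by
    ext s
    simp [mul_sub]

theorem ker_symDefect {K E ι : Type*} [Field K] [AddCommGroup E] [Module K E] [LinearOrder ι]
    {V : Submodule K E} {m : ℕ} (b : Basis ι K V)
    (Bbar : Fin m → (V →ₗ[K] (E ⧸ V) →ₗ[K] K)) :
    LinearMap.ker (symDefect b Bbar) = symTV V Bbar := by
  ext f
  constructor
  · intro hf t
    have h : ∀ i j, i < j → Bbar t (b i) (f (b j)) = Bbar t (b j) (f (b i)) := fun i j hij =>
      sub_eq_zero.1 (congr_fun (LinearMap.mem_ker.1 hf) (t, ⟨(i, j), hij⟩))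
    have h' : (Bbar t).compl₂ f = ((Bbar t).compl₂ f).flip := by
      refine b.ext fun i => b.ext fun j => ?_
      rcases lt_trichotomy i j with hij | rfl | hij
      · exact h i j hij
      · rfl
      · exact (h j i hij).symm
    exact fun v v' => LinearMap.congr_fun (LinearMap.congr_fun h' v) v'
  · intro hf
    refine LinearMap.mem_ker.2 (funext fun s => sub_eq_zero.2 (hf _ _ _))

/-- The space `symTV` has the expected dimension exactly when its defining equations are linearly
independent. -/
theorem finrank_symTV_add_eq_iff_surjective {K E : Type*} [Field K] [AddCommGroup E] [Module K E]
    [FiniteDimensional K E] {V : Submodule K E} {m k : ℕ} (b : Basis (Fin k) K V)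
    (Bbar : Fin m → (V →ₗ[K] (E ⧸ V) →ₗ[K] K)) :
    finrank K (symTV V Bbar) + m * k.choose 2 = k * (finrank K E - k) ↔
      Function.Surjective (symDefect b Bbar) := by
  have hk : finrank K V = k := by simpa using Module.finrank_eq_card_basis b
  have h1 := (symDefect b Bbar).finrank_range_add_finrank_ker
  have h2 := V.finrank_quotient_add_finrank
  have h3 : finrank K (E ⧸ V) = finrank K E - k := by omega
  rw [ker_symDefect, Module.finrank_linearMap, hk, h3] at h1
  have h4 : finrank K (Fin m × {p : Fin k × Fin k // p.1 < p.2} → K) = m * k.choose 2 := by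
    rw [Module.finrank_fintype_fun_eq_card, Fintype.card_prod, Fintype.card_fin,
      card_subtype_fin_prod_lt]
  rw [← LinearMap.range_eq_top]
  constructor
  · intro h
    apply Submodule.eq_top_of_finrank_eq
    omega
  · intro h
    rw [h, finrank_top, h4] at h1
    omega

theorem exists_basis_extending_pair {K V : Type*} [Field K] [AddCommGroup V] [Module K V]
    [FiniteDimensional K V] {k : ℕ} (hk : finrank K V = k) {x y : V}
    (h : LinearIndependent K ![x, y]) :
    ∃ (b : Basis (Fin k) K V) (i j : Fin k), i ≠ j ∧ b i = x ∧ b j = y := by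
  let b := Basis.sumExtend h
  have : Fintype (Fin 2 ⊕ Basis.sumExtendIndex h) :=
    @Fintype.ofFinite _ (Module.Finite.finite_basis b)
  let e := Fintype.equivFinOfCardEq ((Module.finrank_eq_card_basis b).symm.trans hk)
  have hb : ∀ i, b (Sum.inl i) = ![x, y] i := fun i => by
    simp only [b, Basis.sumExtend, Basis.reindex_apply, Basis.extend_apply_self]
    rfl
  exact ⟨b.reindex e, e (Sum.inl 0), e (Sum.inl 1), by simp, by simp [hb], by simp [hb]⟩

theorem exists_degenerate_of_not_surjective
    {K E : Type*} [Field K] [IsAlgClosed K] [AddCommGroup E] [Module K E]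
    [FiniteDimensional K E] (B : Fin 2 → (E →ₗ[K] E →ₗ[K] K))
    (hsymp : ∀ t, IsSymplectic (B t)) {V : Submodule K E} {k : ℕ} (b : Basis (Fin k) K V)
    (Bbar : Fin 2 → (V →ₗ[K] (E ⧸ V) →ₗ[K] K))
    (hBbar : ∀ t (v : V) (e : E),
      Bbar t v (Submodule.Quotient.mk e : E ⧸ V) = B t v e)
    (hns : ¬ Function.Surjective (symDefect b Bbar)) :
    ∃ (c : K) (x y : V), LinearIndependent K ![x, y] ∧
      (∀ e, c * B 0 x e + B 1 x e = 0) ∧ ∀ e, c * B 0 y e + B 1 y e = 0 := by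
  rw [← LinearMap.range_eq_top] at hns
  obtain ⟨φ, hφ0, hφ⟩ := Submodule.exists_le_ker_of_lt_top _ (lt_top_iff_ne_top.2 hns)
  let a : Fin 2 × {p : Fin k × Fin k // p.1 < p.2} → K := fun s => φ (Pi.single s 1)
  have hφa : ∀ g, φ g = ∑ s, g s * a s := fun g => by
    conv_lhs => rw [LinearMap.pi_apply_eq_sum_univ φ g]
    simp only [smul_eq_mul, a]
    refine Finset.sum_congr rfl fun s _ => ?_
    congr 2
    ext j
    simp [Pi.single_apply, eq_comm]
  let w (t : Fin 2) : Dual K V →ₗ[K] V :=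
    ∑ p : {p : Fin k × Fin k // p.1 < p.2}, a (t, p) •
      ((LinearMap.applyₗ (b p.1.1)).smulRight (b p.1.2) -
        (LinearMap.applyₗ (b p.1.2)).smulRight (b p.1.1))
  have hw : ∀ t x, w t x = ∑ p : {p : Fin k × Fin k // p.1 < p.2},
      a (t, p) • (x (b p.1.1) • b p.1.2 - x (b p.1.2) • b p.1.1) := fun t x => by
    simp [w, LinearMap.sum_apply]
  have halt : ∀ t (x : Dual K V), x (w t x) = 0 := fun t x => by
    rw [hw, map_sum]
    refine Finset.sum_eq_zero fun p _ => ?_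
    simp only [map_smul, map_sub, smul_eq_mul]
    ring
  have hrel : ∀ x e, B 0 (w 0 x) e + B 1 (w 1 x) e = 0 := by
    intro x e
    have h := hφ ⟨x.smulRight (Submodule.Quotient.mk e), rfl⟩
    rw [LinearMap.mem_ker, hφa, Fintype.sum_prod_type, Fin.sum_univ_two] at h
    have key : ∀ t, B t (w t x) e = -∑ p : {p : Fin k × Fin k // p.1 < p.2},
        symDefect b Bbar (x.smulRight (Submodule.Quotient.mk e)) (t, p) * a (t, p) := by
      intro t
      rw [← hBbar, hw, map_sum, LinearMap.sum_apply, ← Finset.sum_neg_distrib]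
      refine Finset.sum_congr rfl fun p _ => ?_
      simp only [symDefect, LinearMap.coe_mk, AddHom.coe_mk, LinearMap.smulRight_apply, map_smul,
        map_sub, LinearMap.smul_apply, LinearMap.sub_apply, smul_eq_mul]
      ring
    rw [key, key, ← neg_add, h, neg_zero]
  have hzero : ∀ x, w 0 x = 0 ↔ w 1 x = 0 := by
    intro x
    constructor <;> intro hx
    · refine Subtype.ext ((hsymp 1).2 _ fun e => ?_)
      simpa [hx] using hrel x e
    · refine Subtype.ext ((hsymp 0).2 _ fun e => ?_)
      simpa [hx] using hrel x e
  have hw1 : w 1 ≠ 0 := by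
    intro h1
    have hall : ∀ t, w t = 0 := by
      intro t
      fin_cases t
      · exact LinearMap.ext fun x => (hzero x).2 (by rw [h1, LinearMap.zero_apply])
      · exact h1
    have ha : ∀ s, a s = 0 := by
      rintro ⟨t, p, hp⟩
      have h : b.coord p.2 (w t (b.coord p.1)) = 0 := by rw [hall]; simp
      rw [hw, map_sum, Finset.sum_eq_single ⟨p, hp⟩] at h
      · simpa [Finsupp.single_apply, hp.ne, hp.ne'] using h
      · rintro ⟨q, hq⟩ - hqp
        have h1 : ¬ (q.1 = p.1 ∧ q.2 = p.2) := fun h => hqp (Subtype.ext (Prod.ext h.1 h.2))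
        have h2 : ¬ (q.2 = p.1 ∧ q.1 = p.2) := fun h => by
          rw [h.1, h.2] at hq
          exact lt_asymm hp hq
        simp only [map_smul, map_sub, Basis.coord_apply, Basis.repr_self, Finsupp.single_apply,
          smul_eq_mul]
        grind
      · simp
    exact hφ0 (LinearMap.ext fun g => by simp [hφa, ha])
  obtain ⟨c, x, y, hx, hy, hxy⟩ :=
    exists_pencil_kernel_of_alternating (w 0) (w 1) (halt 0) (halt 1) hzero hw1
  refine ⟨c, w 1 x, w 1 y, hxy, fun e => ?_, fun e => ?_⟩
  · simpa [hx] using hrel x e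
  · simpa [hy] using hrel y e

/-- (Doubly symplectic Grassmannian tangent space, Theorem 1.1.)
Over an algebraically closed field, for two linearly independent symplectic forms
`B 0, B 1` on the `n`-dimensional space `E` and a `k`-dimensional subspace `V` isotropic
with respect to both, `dim T(V) = k(n−k) − 2·(k choose 2)` if and only if there is no
nonzero linear combination `a • B 0 + b • B 1` and 2-dimensional subspace `V' ⊆ V` with
`(a • B 0 + b • B 1)(v', e) = 0` for all `v' ∈ V'`, `e ∈ E`. -/
theorem doubly_symplectic_tangent_dim
    {K E : Type*} [Field K] [IsAlgClosed K] [AddCommGroup E] [Module K E]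
    [FiniteDimensional K E]
    (n k : ℕ) (hn : finrank K E = n)
    (B : Fin 2 → (E →ₗ[K] E →ₗ[K] K))
    (hsymp : ∀ t, IsSymplectic (B t))
    (hind : LinearIndependent K B)
    (V : Submodule K E) (hk : finrank K V = k)
    (hiso : ∀ t, IsIsotropic (B t) V)
    (Bbar : Fin 2 → (V →ₗ[K] (E ⧸ V) →ₗ[K] K))
    (hBbar : ∀ t (v : V) (e : E),
      Bbar t v (Submodule.Quotient.mk e : E ⧸ V) = B t v e) :
    finrank K (symTV V Bbar) + 2 * Nat.choose k 2 = k * (n - k) ↔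
      ¬ ∃ (a b : K) (V' : Submodule K E), ¬ (a = 0 ∧ b = 0) ∧ V' ≤ V ∧
        finrank K V' = 2 ∧ ∀ v' ∈ V', ∀ e : E, a * B 0 v' e + b * B 1 v' e = 0 := by
  subst hn
  constructor
  · rintro h ⟨α, β, V', hαβ, hV', hdim, hdeg⟩
    let c := Module.finBasisOfFinrankEq K V' hdim
    let x : V := Submodule.inclusion hV' (c 0)
    let y : V := Submodule.inclusion hV' (c 1)
    have hxy : LinearIndependent K ![x, y] := by
      have h := c.linearIndependent.map' (Submodule.inclusion hV') (Submodule.ker_inclusion _ _ _)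
      have heq : ![x, y] = Submodule.inclusion hV' ∘ c := by
        funext i
        fin_cases i <;> rfl
      rwa [heq]
    have hzero : ∀ v : V, (v : E) ∈ V' → ∀ z, α * Bbar 0 v z + β * Bbar 1 v z = 0 := by
      intro v hv z
      obtain ⟨e, rfl⟩ := Submodule.Quotient.mk_surjective V z
      rw [hBbar, hBbar]
      exact hdeg v hv e
    obtain ⟨b, i, j, hij, hi, hj⟩ := exists_basis_extending_pair hk hxy
    have hsurj := (finrank_symTV_add_eq_iff_surjective b Bbar).1 h
    have hno : ∀ i j : Fin k, i < j → (b i : E) ∈ V' → (b j : E) ∈ V' → False := by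
      intro i j hij hi hj
      have hcomb : ∀ g : Fin 2 × {p : Fin k × Fin k // p.1 < p.2} → K,
          α * g (0, ⟨(i, j), hij⟩) + β * g (1, ⟨(i, j), hij⟩) = 0 := by
        intro g
        obtain ⟨f, rfl⟩ := hsurj g
        simp only [symDefect, LinearMap.coe_mk, AddHom.coe_mk]
        linear_combination hzero _ hi (f (b j)) - hzero _ hj (f (b i))
      refine hαβ ⟨?_, ?_⟩
      · simpa using hcomb fun s => if s.1 = 0 then 1 else 0
      · simpa using hcomb fun s => if s.1 = 1 then 1 else 0
    have hiV : (b i : E) ∈ V' := by rw [hi]; exact (c 0).2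
    have hjV : (b j : E) ∈ V' := by rw [hj]; exact (c 1).2
    rcases hij.lt_or_gt with h | h
    · exact hno i j h hiV hjV
    · exact hno j i h hjV hiV
  · intro hno
    let b := Module.finBasisOfFinrankEq K V hk
    refine (finrank_symTV_add_eq_iff_surjective b Bbar).2 ?_
    by_contra hns
    obtain ⟨c, x, y, hxy, hx, hy⟩ := exists_degenerate_of_not_surjective B hsymp b Bbar hBbar hns
    have hxy' := hxy.map' V.subtype V.ker_subtype
    refine hno ⟨c, 1, Submodule.span K (Set.range (V.subtype ∘ ![x, y])), by simp, ?_, ?_, ?_⟩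
    · rw [Submodule.span_le]
      rintro _ ⟨i, rfl⟩
      exact (![x, y] i).2
    · simpa using finrank_span_eq_card hxy'
    · intro v hv e
      have hle : Submodule.span K (Set.range (V.subtype ∘ ![x, y])) ≤
          LinearMap.ker ((c • B 0 + B 1).flip e) := by
        rw [Submodule.span_le]
        rintro _ ⟨i, rfl⟩
        fin_cases i
        · simpa using hx e
        · simpa using hy e
      simpa using hle hv
end

section
/- Let K be a field, k a natural number, and let M₁, M₂ be invertible alternating k × k matrices over K. Then for every nonzero scalar d ∈ K, the eigenspace {x ∈ K^k : M₂M₁⁻¹x = d·x} of the matrix M₂M₁⁻¹ for the eigenvalue d has even dimension. -/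
open Module

/-- A square matrix is alternating if it is skew-symmetric with zero diagonal. -/
def Matrix.IsAlternating {K : Type*} [Field K] {k : ℕ}
    (M : Matrix (Fin k) (Fin k) K) : Prop :=
  M.transpose = -M ∧ ∀ i, M i i = 0

/-- Splitting off a hyperbolic plane: a nonzero alternating form can be modified to an alternating
form whose radical is larger by exactly two dimensions. -/
theorem LinearMap.IsAlt.exists_finrank_ker_eq_add_two {K V : Type*} [Field K] [AddCommGroup V]
    [Module K V] [FiniteDimensional K V] {B : V →ₗ[K] V →ₗ[K] K} (hB : B.IsAlt) (h0 : B ≠ 0) :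
    ∃ B' : V →ₗ[K] V →ₗ[K] K, B'.IsAlt ∧
      finrank K (LinearMap.ker B') = finrank K (LinearMap.ker B) + 2 := by
  obtain ⟨x, hx⟩ : ∃ x, B x ≠ 0 := by
    by_contra! h
    exact h0 (LinearMap.ext h)
  obtain ⟨y, hc⟩ : ∃ y, B x y ≠ 0 := by
    by_contra! h
    exact hx (LinearMap.ext h)
  have hyx : B y x = -B x y := (hB.neg x y).symm
  have hxx : B x x = 0 := hB.self_eq_zero x
  have hyy : B y y = 0 := hB.self_eq_zero y
  let B' : V →ₗ[K] V →ₗ[K] K :=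
    B - (B x y)⁻¹ • ((B x).smulRight (B y) - (B y).smulRight (B x))
  have hB' : ∀ u v, B' u v = B u v - (B x y)⁻¹ * (B x u * B y v - B y u * B x v) := by
    intro u v
    simp [B']
  have hx' : x ∈ LinearMap.ker B' := by
    rw [LinearMap.mem_ker]
    ext v
    rw [hB', hxx, hyx, LinearMap.zero_apply]
    field_simp
    ring
  have hy' : y ∈ LinearMap.ker B' := by
    rw [LinearMap.mem_ker]
    ext v
    rw [hB', hyy, LinearMap.zero_apply]
    field_simp
    ring
  refine ⟨B', fun u => ?_, ?_⟩
  · rw [hB', hB.self_eq_zero]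
    ring
  let F : LinearMap.ker B' →ₗ[K] K × K := ((B x).prod (B y)).domRestrict (LinearMap.ker B')
  have hF : ∀ u, F u = (B x u, B y u) := fun u => rfl
  have hFsurj : LinearMap.range F = ⊤ := by
    rw [LinearMap.range_eq_top]
    rintro ⟨a, b⟩
    refine ⟨(a * (B x y)⁻¹) • ⟨y, hy'⟩ - (b * (B x y)⁻¹) • ⟨x, hx'⟩, ?_⟩
    rw [hF]
    simp [hxx, hyy, hyx, hc]
  have hle : LinearMap.ker B ≤ LinearMap.ker B' := by
    intro u hu
    have hu0 : ∀ w, B u w = 0 := fun w => by rw [LinearMap.mem_ker.1 hu]; rfl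
    have hu1 : ∀ w, B w u = 0 := fun w => by rw [← hB.neg u w, hu0, neg_zero]
    rw [LinearMap.mem_ker]
    ext v
    rw [hB', hu0, hu1, hu1]
    simp
  have hker : LinearMap.ker F = (LinearMap.ker B).comap (LinearMap.ker B').subtype := by
    ext ⟨u, hu⟩
    have hu' : ∀ v, B' u v = 0 := fun v => by rw [LinearMap.mem_ker.1 hu]; rfl
    simp only [LinearMap.mem_ker, hF, Submodule.mem_comap, Submodule.subtype_apply,
      Prod.mk_eq_zero]
    constructor
    · rintro ⟨h1, h2⟩
      ext v
      have := hu' v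
      rw [hB', h1, h2] at this
      simpa using this
    · intro h
      rw [← hB.neg u x, ← hB.neg u y, h]
      simp
  have hrn := LinearMap.finrank_range_add_finrank_ker F
  rw [hFsurj, finrank_top, Module.finrank_prod, Module.finrank_self, hker,
    (Submodule.comapSubtypeEquivOfLe hle).finrank_eq] at hrn
  omega

/-- The radical of an alternating form has even codimension. -/
theorem LinearMap.IsAlt.even_finrank_add_finrank_ker {K V : Type*} [Field K] [AddCommGroup V]
    [Module K V] [FiniteDimensional K V] {B : V →ₗ[K] V →ₗ[K] K} (hB : B.IsAlt) :
    Even (finrank K V + finrank K (LinearMap.ker B)) := by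
  induction h : finrank K V - finrank K (LinearMap.ker B) using Nat.strong_induction_on
    generalizing B with
  | _ n ih =>
    by_cases h0 : B = 0
    · subst h0
      rw [LinearMap.ker_zero, finrank_top]
      exact ⟨_, rfl⟩
    · obtain ⟨B', hB', hdim⟩ := hB.exists_finrank_ker_eq_add_two h0
      have hle := Submodule.finrank_le (LinearMap.ker B')
      have := ih _ (by omega) hB' rfl
      rw [hdim] at this
      grind

/-- The bilinear form of an alternating matrix is alternating. -/
theorem Matrix.IsAlternating.isAlt_toLinearMap₂' {K : Type*} [Field K] {k : ℕ}
    {M : Matrix (Fin k) (Fin k) K} (hM : M.IsAlternating) :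
    (Matrix.toLinearMap₂' K M : (Fin k → K) →ₗ[K] (Fin k → K) →ₗ[K] K).IsAlt := by
  intro x
  have hskew : ∀ i j, M j i = -M i j := fun i j => congrFun (congrFun hM.1 i) j
  rw [Matrix.toLinearMap₂'_apply, ← Fintype.sum_prod_type']
  refine Finset.sum_involution (fun p _ => p.swap) ?_ ?_ (fun _ _ => Finset.mem_univ _)
    (fun p _ => p.swap_swap)
  · rintro ⟨i, j⟩ -
    simp only [Prod.swap, smul_eq_mul, hskew i j]
    ring
  · rintro ⟨i, j⟩ - hne heq
    obtain rfl : j = i := congrArg Prod.fst heq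
    simp [hM.2] at hne

/-- The null space of an alternating matrix has even codimension. -/
theorem Matrix.IsAlternating.even_add_finrank_ker {K : Type*} [Field K] {k : ℕ}
    {M : Matrix (Fin k) (Fin k) K} (hM : M.IsAlternating) :
    Even (k + finrank K (LinearMap.ker (Matrix.toLin' M))) := by
  have hker : LinearMap.ker
      (Matrix.toLinearMap₂' K M : (Fin k → K) →ₗ[K] (Fin k → K) →ₗ[K] K) =
        LinearMap.ker (Matrix.toLin' M) := by
    ext x
    have hx : ∀ y, Matrix.toLinearMap₂' K M x y = -(dotProduct (M.mulVec x) y) := by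
      intro y
      rw [Matrix.toLinearMap₂'_apply', Matrix.dotProduct_mulVec, ← Matrix.mulVec_transpose, hM.1,
        Matrix.neg_mulVec, neg_dotProduct]
    rw [LinearMap.mem_ker, LinearMap.mem_ker, Matrix.toLin'_apply, ← dotProduct_eq_zero_iff,
      LinearMap.ext_iff]
    simp [hx]
  have h := hM.isAlt_toLinearMap₂'.even_finrank_add_finrank_ker
  rwa [hker, Module.finrank_fin_fun] at h

/-- If `M₁, M₂` are invertible alternating `k × k` matrices over a field
`K`, then for every nonzero `d ∈ K` the eigenspace `{x | M₂M₁⁻¹ x = d • x}` of `M₂M₁⁻¹`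
is even-dimensional. -/
theorem eigenspace_even_dim
    {K : Type*} [Field K] (k : ℕ) (M₁ M₂ : Matrix (Fin k) (Fin k) K)
    (h₁alt : M₁.IsAlternating) (h₂alt : M₂.IsAlternating)
    (h₁inv : IsUnit M₁) (h₂inv : IsUnit M₂)
    (d : K) (hd : d ≠ 0) :
    Even (finrank K (Module.End.eigenspace (Matrix.toLin' (M₂ * M₁⁻¹)) d)) := by
  have hdet : IsUnit M₁.det := (Matrix.isUnit_iff_isUnit_det _).1 h₁inv
  have hN : (M₂ - d • M₁).IsAlternating := by
    refine ⟨?_, fun i => by simp [h₁alt.2, h₂alt.2]⟩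
    rw [Matrix.transpose_sub, Matrix.transpose_smul, h₁alt.1, h₂alt.1, smul_neg]
    abel
  have hk : Even k := by
    have hbot : LinearMap.ker (Matrix.toLin' M₁) = ⊥ := by
      rw [Matrix.ker_toLin'_eq_bot_iff]
      exact fun v hv => Matrix.eq_zero_of_mulVec_eq_zero hdet.ne_zero hv
    have h := h₁alt.even_add_finrank_ker
    rwa [hbot, finrank_bot, add_zero] at h
  let e : (Fin k → K) ≃ₗ[K] (Fin k → K) := Matrix.toLin'OfInv (M := M₁⁻¹) (M' := M₁)
    (Matrix.nonsing_inv_mul _ hdet) (Matrix.mul_nonsing_inv _ hdet)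
  have hmap : LinearMap.ker (Matrix.toLin' (M₂ - d • M₁)) =
      (Module.End.eigenspace (Matrix.toLin' (M₂ * M₁⁻¹)) d).comap e.toLinearMap := by
    ext y
    have hey : e y = M₁.mulVec y := rfl
    rw [Submodule.mem_comap, LinearEquiv.coe_coe, Module.End.mem_eigenspace_iff, hey,
      LinearMap.mem_ker, Matrix.toLin'_apply, Matrix.toLin'_apply, Matrix.mulVec_mulVec,
      Matrix.nonsing_inv_mul_cancel_right _ _ hdet, Matrix.sub_mulVec, Matrix.smul_mulVec,
      sub_eq_zero]
  have hfin : finrank K (LinearMap.ker (Matrix.toLin' (M₂ - d • M₁))) =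
      finrank K (Module.End.eigenspace (Matrix.toLin' (M₂ * M₁⁻¹)) d) := by
    rw [hmap]
    exact (e.ofSubmodule' _).finrank_eq
  rw [← hfin]
  exact (Nat.even_add.1 hN.even_add_finrank_ker).1 hk
end
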